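/- Let r and t be real numbers with 0 < r < 1 and 0 < t ≤ 1, let d ≥ 1, and let ψ be a tripartite pure state on ℂ^d ⊗ ℂ^d ⊗ ℂ^d with single-party reduced density matrices ρ_A, ρ_B, ρ_C. Define h(ρ) = ((tr ρ^r)^t − 1)/((1−r)·t) and l_d = d^{(1−r)t}. Then min{h(ρ_A), h(ρ_B), h(ρ_C)} ≥ h(ρ_A) + h(ρ_B) + h(ρ_C) − 2·(l_d − 1)/((1−r)·t). (This is the tripartite pure-state case of the lower bounds relating the genuine entanglement measure E_{g(r,t)}, the bipartite cut entanglements, and the global measure E^{(3)}_{r,t} = (1/2)(h(ρ_A)+h(ρ_B)+h(ρ_C)), since for a tripartite pure state every bipartition has a single-party side.) -/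

import Mathlib

open scoped Kronecker Matrix ComplexOrder

/-- `tr ρ^α` for a Hermitian matrix `ρ`: the sum of the `α`-th real powers of its
eigenvalues, counted with multiplicity (`0^α = 0` for `α > 0`);
junk value `0` for non-Hermitian input. -/
noncomputable def trRPow {n : Type*} [Fintype n] [DecidableEq n]
    (ρ : Matrix n n ℂ) (α : ℝ) : ℝ :=
  if h : ρ.IsHermitian then ∑ i, h.eigenvalues i ^ α else 0

/-- `ρ^α` for a Hermitian matrix `ρ`, via the spectral decomposition: raise every
eigenvalue to the real power `α` (`0^α = 0` for `α ≠ 0`);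
junk value `0` for non-Hermitian input. -/
noncomputable def matRPow {n : Type*} [Fintype n] [DecidableEq n]
    (ρ : Matrix n n ℂ) (α : ℝ) : Matrix n n ℂ :=
  if h : ρ.IsHermitian then
    (h.eigenvectorUnitary : Matrix n n ℂ) *
      Matrix.diagonal (fun i => ((h.eigenvalues i ^ α : ℝ) : ℂ)) *
      star (h.eigenvectorUnitary : Matrix n n ℂ)
  else 0

/-- The power mean bound `tr ρ^r ≤ n^(1-r)` for a density matrix `ρ` of size `n`. -/
theorem trRPow_le_card_rpow {n : Type*} [Fintype n] [DecidableEq n] [Nonempty n]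
    {ρ : Matrix n n ℂ} (hρ : ρ.PosSemidef) (htr : ρ.trace = 1) {r : ℝ}
    (hr0 : 0 ≤ r) (hr1 : r ≤ 1) :
    trRPow ρ r ≤ (Fintype.card n : ℝ) ^ (1 - r) := by
  have hn : (0 : ℝ) < Fintype.card n := by exact_mod_cast Fintype.card_pos
  have hsum : ∑ i, hρ.isHermitian.eigenvalues i = 1 := by
    have h := hρ.isHermitian.trace_eq_sum_eigenvalues
    rw [htr] at h
    exact Complex.ofReal_injective (by simpa using h.symm)
  have jensen := (Real.concaveOn_rpow hr0 hr1).le_map_sum (t := Finset.univ)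
    (w := fun _ : n => (Fintype.card n : ℝ)⁻¹) (p := hρ.isHermitian.eigenvalues)
    (fun _ _ => by positivity) (by simp [hn.ne'])
    (fun i _ => hρ.eigenvalues_nonneg i)
  simp only [smul_eq_mul, ← Finset.mul_sum, hsum, mul_one] at jensen
  rw [trRPow, dif_pos hρ.isHermitian, Real.rpow_sub hn, Real.rpow_one, div_eq_mul_inv,
    ← Real.inv_rpow hn.le]
  rwa [inv_mul_le_iff₀ hn] at jensen

theorem trRPow_nonneg {n : Type*} [Fintype n] [DecidableEq n]
    {ρ : Matrix n n ℂ} (hρ : ρ.PosSemidef) (r : ℝ) : 0 ≤ trRPow ρ r := by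
  rw [trRPow, dif_pos hρ.isHermitian]
  exact Finset.sum_nonneg fun i _ => Real.rpow_nonneg (hρ.eigenvalues_nonneg i) r

/-- The reduced density matrix of a bipartite pure state obeys
`(tr ρ^r)^t ≤ n^((1-r)t)`. -/
theorem trRPow_reduced_rpow_le {n m : Type*} [Fintype n] [DecidableEq n] [Nonempty n]
    [Fintype m] (φ : n → m → ℂ) (hφ : ∑ i, ∑ j, ‖φ i j‖ ^ 2 = 1) {r t : ℝ}
    (hr0 : 0 ≤ r) (hr1 : r ≤ 1) (ht : 0 ≤ t) :
    trRPow (Matrix.of fun i i' => ∑ j, φ i j * (starRingEnd ℂ) (φ i' j)) r ^ t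
      ≤ (Fintype.card n : ℝ) ^ ((1 - r) * t) := by
  have hpos : (Matrix.of fun i i' => ∑ j, φ i j * (starRingEnd ℂ) (φ i' j)).PosSemidef :=
    Matrix.posSemidef_self_mul_conjTranspose (Matrix.of φ)
  have htr : (Matrix.of fun i i' => ∑ j, φ i j * (starRingEnd ℂ) (φ i' j)).trace = 1 := by
    simp only [Matrix.trace, Matrix.diag_apply, Matrix.of_apply, Complex.mul_conj']
    exact_mod_cast hφ
  rw [Real.rpow_mul (Nat.cast_nonneg _)]
  exact Real.rpow_le_rpow (trRPow_nonneg hpos r) (trRPow_le_card_rpow hpos htr hr0 hr1) ht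

/-- **Propositions 3 & 4, tripartite pure-state case, (r,t)-version.**
For `0 < r < 1`, `0 < t ≤ 1`, `d ≥ 1` and a tripartite pure state `ψ` with
single-party reduced states `ρ_A, ρ_B, ρ_C`, with `h(ρ) = ((tr ρ^r)^t - 1)/((1-r)t)`
and `l_d = d^{(1-r)t}`:
`min{h(ρ_A), h(ρ_B), h(ρ_C)} ≥ h(ρ_A) + h(ρ_B) + h(ρ_C) - 2(l_d - 1)/((1-r)t)`. -/
theorem genuine_lower_bound_rt
    {d : ℕ} (hd : 1 ≤ d) (r t : ℝ) (hr0 : 0 < r) (hr1 : r < 1) (ht0 : 0 < t) (ht1 : t ≤ 1)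
    (ψ : Fin d × Fin d × Fin d → ℂ) (hψ : ∑ x, ‖ψ x‖ ^ 2 = 1) :
    let ρA : Matrix (Fin d) (Fin d) ℂ :=
      Matrix.of fun a a' => ∑ b, ∑ c, ψ (a, b, c) * (starRingEnd ℂ) (ψ (a', b, c))
    let ρB : Matrix (Fin d) (Fin d) ℂ :=
      Matrix.of fun b b' => ∑ a, ∑ c, ψ (a, b, c) * (starRingEnd ℂ) (ψ (a, b', c))
    let ρC : Matrix (Fin d) (Fin d) ℂ :=
      Matrix.of fun c c' => ∑ a, ∑ b, ψ (a, b, c) * (starRingEnd ℂ) (ψ (a, b, c'))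
    let h : Matrix (Fin d) (Fin d) ℂ → ℝ := fun ρ => (trRPow ρ r ^ t - 1) / ((1 - r) * t)
    let ld : ℝ := (d : ℝ) ^ ((1 - r) * t)
    h ρA + h ρB + h ρC - 2 * (ld - 1) / ((1 - r) * t)
      ≤ min (h ρA) (min (h ρB) (h ρC)) := by
  intro ρA ρB ρC h ld
  have : Nonempty (Fin d) := ⟨⟨0, hd⟩⟩
  have hden : 0 < (1 - r) * t := mul_pos (by linarith) ht0
  have hsum : ∑ a, ∑ b, ∑ c, ‖ψ (a, b, c)‖ ^ 2 = 1 := by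
    simpa only [Fintype.sum_prod_type] using hψ
  have hA : trRPow ρA r ^ t ≤ ld := by
    simpa only [Fintype.sum_prod_type, Fintype.card_fin] using
      trRPow_reduced_rpow_le (fun a (x : Fin d × Fin d) => ψ (a, x.1, x.2))
        (by simpa only [Fintype.sum_prod_type] using hsum) hr0.le hr1.le ht0.le
  have hB : trRPow ρB r ^ t ≤ ld := by
    simpa only [Fintype.sum_prod_type, Fintype.card_fin] using
      trRPow_reduced_rpow_le (fun b (x : Fin d × Fin d) => ψ (x.1, b, x.2))
        (by simp only [Fintype.sum_prod_type]; rw [Finset.sum_comm]; exact hsum)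
        hr0.le hr1.le ht0.le
  have hC : trRPow ρC r ^ t ≤ ld := by
    simpa only [Fintype.sum_prod_type, Fintype.card_fin] using
      trRPow_reduced_rpow_le (fun c (x : Fin d × Fin d) => ψ (x.1, x.2, c))
        (by
          rw [Finset.sum_comm]
          simpa only [Fintype.sum_prod_type] using hsum) hr0.le hr1.le ht0.le
  have bound : ∀ ρ, trRPow ρ r ^ t ≤ ld → h ρ ≤ (ld - 1) / ((1 - r) * t) := fun ρ hρ =>
    div_le_div_of_nonneg_right (sub_le_sub_right hρ 1) hden.le
  have hA' := bound ρA hA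
  have hB' := bound ρB hB
  have hC' := bound ρC hC
  rw [mul_div_assoc]
  refine le_min ?_ (le_min ?_ ?_) <;> linarith
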